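/- Let Y = ξ + ω S Z, where Z ~ SN_d(0, Ω̄, α) and S > 0 is a scalar random variable independent of Z with E(S⁴) < ∞. Set δ = Ω̄α/(1 + αᵀΩ̄α)^{1/2}, δ* = (δᵀΩ̄⁻¹δ)^{1/2}, σ*² = E(S²) − (2/π)E(S)²δ*², and let β₂* denote the Pearson kurtosis index of the scalar variable Y₁* = S W with W ~ SN₁(0,1,α*) independent of S, α* = (αᵀΩ̄α)^{1/2}. Then the Mardia multivariate excess kurtosis index of Y is γ_{2,d} = β₂* + (d−1)(d+1) E(S⁴)/E(S²)² + [2(d−1)/(E(S²)σ*²)] { E(S⁴) + [E(S)²E(S²) − 2E(S)E(S³)] (2/π) δ*² } − d(d+2). -/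

import Mathlib

open MeasureTheory ProbabilityTheory Matrix

noncomputable section

/-- Standard normal density. -/
def stdNormalPDF (x : ℝ) : ℝ := (Real.sqrt (2 * Real.pi))⁻¹ * Real.exp (-x ^ 2 / 2)

/-- Standard normal cumulative distribution function `Φ`. -/
def stdNormalCDF (x : ℝ) : ℝ := ∫ t in Set.Iic x, stdNormalPDF t

/-- Density `φ_d(x; Ω)` of the centered multivariate normal `N_d(0, Ω)`. -/
def mvnPDF {d : ℕ} (Ωm : Matrix (Fin d) (Fin d) ℝ) (x : Fin d → ℝ) : ℝ :=
  (2 * Real.pi) ^ (-(d : ℝ) / 2) * Ωm.det ^ (-(1 : ℝ) / 2) *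
    Real.exp (-(x ⬝ᵥ (Ωm⁻¹ *ᵥ x)) / 2)

/-- The diagonal matrix `ω` of scale parameters, `ω_ii = √(Ω_ii)`. -/
def scaleMat {d : ℕ} (Ωm : Matrix (Fin d) (Fin d) ℝ) : Matrix (Fin d) (Fin d) ℝ :=
  Matrix.diagonal fun i => Real.sqrt (Ωm i i)

/-- The correlation matrix `Ω̄ = ω⁻¹ Ω ω⁻¹`. -/
def corrMat {d : ℕ} (Ωm : Matrix (Fin d) (Fin d) ℝ) : Matrix (Fin d) (Fin d) ℝ :=
  (scaleMat Ωm)⁻¹ * Ωm * (scaleMat Ωm)⁻¹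

/-- Density of the multivariate skew-normal distribution `SN_d(ξ, Ω, α)`. -/
def snPDF {d : ℕ} (ξ : Fin d → ℝ) (Ωm : Matrix (Fin d) (Fin d) ℝ) (α : Fin d → ℝ)
    (z : Fin d → ℝ) : ℝ :=
  2 * mvnPDF Ωm (z - ξ) * stdNormalCDF (α ⬝ᵥ ((scaleMat Ωm)⁻¹ *ᵥ (z - ξ)))

/-- `Z ~ SN_d(ξ, Ω, α)`. -/
def IsSN {Ω' : Type*} [MeasurableSpace Ω'] (P : Measure Ω') {d : ℕ}
    (Z : Ω' → Fin d → ℝ) (ξ : Fin d → ℝ) (Ωm : Matrix (Fin d) (Fin d) ℝ)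
    (α : Fin d → ℝ) : Prop :=
  Measure.map Z P = volume.withDensity fun z => ENNReal.ofReal (snPDF ξ Ωm α z)

/-- Density of the univariate skew-normal distribution `SN₁(0,1,α)`. -/
def sn1PDF (α x : ℝ) : ℝ := 2 * stdNormalPDF x * stdNormalCDF (α * x)

/-- The vector `δ = Ω̄α / (1 + αᵀΩ̄α)^{1/2}`. -/
def deltaOf {d : ℕ} (Ωb : Matrix (Fin d) (Fin d) ℝ) (α : Fin d → ℝ) : Fin d → ℝ :=
  (Real.sqrt (1 + α ⬝ᵥ (Ωb *ᵥ α)))⁻¹ • (Ωb *ᵥ α)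

lemma stdNormalPDF_eq_gaussianPDFReal : stdNormalPDF = gaussianPDFReal 0 1 := by
  ext x
  simp [stdNormalPDF, gaussianPDFReal]

lemma stdNormalPDF_nonneg (x : ℝ) : 0 ≤ stdNormalPDF x := by
  unfold stdNormalPDF
  positivity

lemma stdNormalPDF_neg (x : ℝ) : stdNormalPDF (-x) = stdNormalPDF x := by
  simp [stdNormalPDF]

lemma continuous_stdNormalPDF : Continuous stdNormalPDF := by
  unfold stdNormalPDF
  fun_prop

lemma integrable_stdNormalPDF : Integrable stdNormalPDF := by
  rw [stdNormalPDF_eq_gaussianPDFReal]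
  exact integrable_gaussianPDFReal 0 1

lemma integral_stdNormalPDF : ∫ x, stdNormalPDF x = 1 := by
  rw [stdNormalPDF_eq_gaussianPDFReal]
  exact integral_gaussianPDFReal_eq_one 0 one_ne_zero

lemma hasDerivAt_stdNormalPDF (x : ℝ) : HasDerivAt stdNormalPDF (-x * stdNormalPDF x) x := by
  have h : HasDerivAt (fun x : ℝ => -x ^ 2 / 2) (-x) x := by
    refine ((hasDerivAt_pow 2 x).neg.div_const 2).congr_deriv ?_
    norm_num
    ring
  refine (h.exp.const_mul (Real.sqrt (2 * Real.pi))⁻¹).congr_deriv ?_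
  unfold stdNormalPDF
  ring

lemma stdNormalCDF_nonneg (x : ℝ) : 0 ≤ stdNormalCDF x :=
  integral_nonneg stdNormalPDF_nonneg

lemma stdNormalCDF_add_neg (x : ℝ) : stdNormalCDF x + stdNormalCDF (-x) = 1 := by
  have h : stdNormalCDF (-x) = ∫ t in Set.Ioi x, stdNormalPDF t := by
    rw [stdNormalCDF, ← integral_comp_neg_Ioi]
    simp_rw [stdNormalPDF_neg]
  rw [h, stdNormalCDF, ← integral_stdNormalPDF]
  exact intervalIntegral.integral_Iic_add_Ioi integrable_stdNormalPDF.integrableOn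
    integrable_stdNormalPDF.integrableOn

lemma stdNormalCDF_le_one (x : ℝ) : stdNormalCDF x ≤ 1 := by
  linarith [stdNormalCDF_add_neg x, stdNormalCDF_nonneg (-x)]

lemma hasDerivAt_stdNormalCDF (x : ℝ) : HasDerivAt stdNormalCDF (stdNormalPDF x) x := by
  have h : stdNormalCDF = fun y => stdNormalCDF 0 + ∫ t in (0 : ℝ)..y, stdNormalPDF t := by
    ext y
    have := intervalIntegral.integral_Iic_sub_Iic
      (integrable_stdNormalPDF.integrableOn (s := Set.Iic 0))
      (integrable_stdNormalPDF.integrableOn (s := Set.Iic y))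
    simp only [stdNormalCDF]
    linarith
  rw [h]
  exact (intervalIntegral.integral_hasDerivAt_right
    (continuous_stdNormalPDF.intervalIntegrable _ _)
    (continuous_stdNormalPDF.stronglyMeasurableAtFilter _ _)
    continuous_stdNormalPDF.continuousAt).const_add _

lemma continuous_stdNormalCDF : Continuous stdNormalCDF :=
  continuous_iff_continuousAt.2 fun x => (hasDerivAt_stdNormalCDF x).continuousAt

lemma integrable_pow_mul_stdNormalPDF (k : ℕ) :
    Integrable fun x : ℝ => x ^ k * stdNormalPDF x := by
  have h := (memLp_id_gaussianReal (μ := 0) (v := 1) k).integrable_norm_pow'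
  rw [gaussianReal_of_var_ne_zero 0 one_ne_zero, integrable_withDensity_iff
    (measurable_gaussianPDF 0 1) (by simp [gaussianPDF_lt_top])] at h
  refine h.mono' (by have := continuous_stdNormalPDF; fun_prop) (ae_of_all _ fun x => ?_)
  rw [toReal_gaussianPDF, ← stdNormalPDF_eq_gaussianPDFReal, norm_mul, norm_pow,
    Real.norm_of_nonneg (stdNormalPDF_nonneg x)]
  rfl

lemma sn1PDF_nonneg (b x : ℝ) : 0 ≤ sn1PDF b x :=
  mul_nonneg (mul_nonneg zero_le_two (stdNormalPDF_nonneg x)) (stdNormalCDF_nonneg _)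

lemma continuous_sn1PDF (b : ℝ) : Continuous (sn1PDF b) := by
  have h1 := continuous_stdNormalPDF
  have h2 := continuous_stdNormalCDF
  unfold sn1PDF
  fun_prop

lemma integrable_pow_mul_sn1PDF (b : ℝ) (k : ℕ) : Integrable fun x : ℝ => x ^ k * sn1PDF b x := by
  have h1 := continuous_sn1PDF b
  refine ((integrable_pow_mul_stdNormalPDF k).norm.const_mul 2).mono' (by fun_prop)
    (ae_of_all _ fun x => ?_)
  simp only [sn1PDF, norm_mul, Real.norm_of_nonneg (stdNormalPDF_nonneg _),
    Real.norm_of_nonneg (stdNormalCDF_nonneg _), Real.norm_ofNat]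
  nlinarith [mul_le_of_le_one_right (mul_nonneg (norm_nonneg (x ^ k)) (stdNormalPDF_nonneg x))
    (stdNormalCDF_le_one (b * x))]

/-- Even moments of the skew-normal law are those of the standard normal law. -/
lemma integral_even_pow_mul_sn1PDF (b : ℝ) {k : ℕ} (hk : Even k) :
    ∫ x, x ^ k * sn1PDF b x = ∫ x, x ^ k * stdNormalPDF x := by
  have h : ∫ x, x ^ k * sn1PDF b x = ∫ x, x ^ k * sn1PDF b (-x) := by
    rw [← integral_neg_eq_self]
    simp_rw [hk.neg_pow]
  have hi : Integrable fun x : ℝ => x ^ k * sn1PDF b (-x) := by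
    simpa [hk.neg_pow] using (integrable_pow_mul_sn1PDF b k).comp_neg
  have h2 : ∫ x, x ^ k * sn1PDF b x + x ^ k * sn1PDF b (-x)
      = ∫ x, 2 * (x ^ k * stdNormalPDF x) := by
    refine integral_congr_ae (ae_of_all _ fun x => ?_)
    have := stdNormalCDF_add_neg (b * x)
    simp only [sn1PDF, stdNormalPDF_neg, mul_neg]
    linear_combination (2 * x ^ k * stdNormalPDF x) * this
  rw [integral_add (integrable_pow_mul_sn1PDF b k) hi, integral_const_mul, ← h] at h2
  linarith

lemma integral_pow_add_two_mul_stdNormalPDF (k : ℕ) :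
    ∫ x, x ^ (k + 2) * stdNormalPDF x = (k + 1) * ∫ x, x ^ k * stdNormalPDF x := by
  have h := integral_mul_deriv_eq_deriv_mul_of_integrable (u := fun x : ℝ => x ^ (k + 1))
    (u' := fun x => (k + 1) * x ^ k) (v := stdNormalPDF) (v' := fun x => -x * stdNormalPDF x)
    (fun x _ => by simpa using hasDerivAt_pow (k + 1) x) (fun x _ => hasDerivAt_stdNormalPDF x)
    ((integrable_pow_mul_stdNormalPDF (k + 2)).neg.congr
      (ae_of_all _ fun x => by simp only [Pi.mul_apply, Pi.neg_apply]; ring))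
    (((integrable_pow_mul_stdNormalPDF k).const_mul (k + 1 : ℝ)).congr
      (ae_of_all _ fun x => by simp only [Pi.mul_apply]; ring))
    (integrable_pow_mul_stdNormalPDF (k + 1))
  have e1 : ∀ x : ℝ, x ^ (k + 1) * (-x * stdNormalPDF x) = -(x ^ (k + 2) * stdNormalPDF x) :=
    fun x => by ring
  simp_rw [e1, integral_neg, mul_assoc, integral_const_mul] at h
  linarith

lemma integral_mul_sn1PDF (b : ℝ) :
    ∫ x, x * sn1PDF b x = Real.sqrt (2 / Real.pi) * (b / Real.sqrt (1 + b ^ 2)) := by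
  have hc := continuous_stdNormalPDF
  have hC := continuous_stdNormalCDF
  have hi1 : Integrable fun x : ℝ => stdNormalCDF (b * x) * (-x * stdNormalPDF x) := by
    refine ((integrable_pow_mul_sn1PDF b 1).const_mul (-(1 / 2))).congr (ae_of_all _ fun x => ?_)
    simp only [sn1PDF]
    ring
  have hi2 : Integrable fun x : ℝ => stdNormalPDF (b * x) * b * stdNormalPDF x := by
    refine (integrable_stdNormalPDF.const_mul ((Real.sqrt (2 * Real.pi))⁻¹ * |b|)).mono'
      (by fun_prop) (ae_of_all _ fun x => ?_)
    rw [norm_mul, norm_mul, Real.norm_of_nonneg (stdNormalPDF_nonneg _),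
      Real.norm_of_nonneg (stdNormalPDF_nonneg x), Real.norm_eq_abs]
    refine mul_le_mul_of_nonneg_right (mul_le_mul_of_nonneg_right ?_ (abs_nonneg b))
      (stdNormalPDF_nonneg x)
    refine mul_le_of_le_one_right (by positivity) (Real.exp_le_one_iff.2 ?_)
    nlinarith [sq_nonneg (b * x)]
  have hi3 : Integrable fun x : ℝ => stdNormalCDF (b * x) * stdNormalPDF x := by
    refine ((integrable_pow_mul_sn1PDF b 0).const_mul (1 / 2)).congr (ae_of_all _ fun x => ?_)
    simp only [sn1PDF]
    ring
  have h := integral_mul_deriv_eq_deriv_mul_of_integrable (u := fun x : ℝ => stdNormalCDF (b * x))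
    (u' := fun x => stdNormalPDF (b * x) * b) (v := stdNormalPDF)
    (v' := fun x => -x * stdNormalPDF x)
    (fun x _ => (hasDerivAt_stdNormalCDF (b * x)).comp x
      (by simpa using (hasDerivAt_id x).const_mul b))
    (fun x _ => hasDerivAt_stdNormalPDF x) hi1 hi2 hi3
  have e1 : ∀ x : ℝ, x * sn1PDF b x = -2 * (stdNormalCDF (b * x) * (-x * stdNormalPDF x)) :=
    fun x => by simp only [sn1PDF]; ring
  have e2 : ∀ x : ℝ, stdNormalPDF (b * x) * b * stdNormalPDF x
      = (b / (2 * Real.pi)) * Real.exp (-((1 + b ^ 2) / 2) * x ^ 2) := fun x => by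
    have hs : (Real.sqrt (2 * Real.pi))⁻¹ * (Real.sqrt (2 * Real.pi))⁻¹ = (2 * Real.pi)⁻¹ := by
      rw [← mul_inv, Real.mul_self_sqrt (by positivity)]
    have he : Real.exp (-((1 + b ^ 2) / 2) * x ^ 2)
        = Real.exp (-(b * x) ^ 2 / 2) * Real.exp (-x ^ 2 / 2) := by
      rw [← Real.exp_add]
      congr 1
      ring
    simp only [stdNormalPDF]
    rw [he, div_eq_mul_inv b, ← hs]
    ring
  simp_rw [e1, integral_const_mul, h, e2, integral_const_mul, integral_gaussian]
  have hpi := Real.pi_pos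
  have e3 : Real.pi / ((1 + b ^ 2) / 2) = Real.pi ^ 2 * (2 / Real.pi) / (1 + b ^ 2) := by
    field_simp
  rw [e3, Real.sqrt_div' _ (by positivity), Real.sqrt_mul (by positivity),
    Real.sqrt_sq hpi.le]
  field_simp

/-- The univariate skew-normal law `SN₁(0,1,b)`. -/
def snMeasure (b : ℝ) : Measure ℝ := volume.withDensity fun x => ENNReal.ofReal (sn1PDF b x)

lemma integral_snMeasure (b : ℝ) (f : ℝ → ℝ) :
    ∫ x, f x ∂snMeasure b = ∫ x, f x * sn1PDF b x := by
  rw [snMeasure, integral_withDensity_eq_integral_toReal_smul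
    (continuous_sn1PDF b).measurable.ennreal_ofReal (by simp)]
  simp_rw [ENNReal.toReal_ofReal (sn1PDF_nonneg b _), smul_eq_mul, mul_comm]

lemma integral_sn1PDF (b : ℝ) : ∫ x, sn1PDF b x = 1 := by
  simpa [integral_stdNormalPDF] using integral_even_pow_mul_sn1PDF b (k := 0) (by simp)

instance (b : ℝ) : IsProbabilityMeasure (snMeasure b) := by
  refine ⟨?_⟩
  have h := integrable_pow_mul_sn1PDF b 0
  simp only [pow_zero, one_mul] at h
  rw [snMeasure, withDensity_apply _ MeasurableSet.univ, Measure.restrict_univ,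
    ← ofReal_integral_eq_lintegral_ofReal h (ae_of_all _ (sn1PDF_nonneg b)), integral_sn1PDF,
    ENNReal.ofReal_one]

lemma integrable_pow_snMeasure (b : ℝ) (k : ℕ) : Integrable (fun x => x ^ k) (snMeasure b) := by
  rw [snMeasure, integrable_withDensity_iff
    (continuous_sn1PDF b).measurable.ennreal_ofReal (by simp)]
  simp_rw [ENNReal.toReal_ofReal (sn1PDF_nonneg b _)]
  exact integrable_pow_mul_sn1PDF b k

lemma integral_id_snMeasure (b : ℝ) :
    ∫ x, x ∂snMeasure b = Real.sqrt (2 / Real.pi) * (b / Real.sqrt (1 + b ^ 2)) := by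
  rw [integral_snMeasure, integral_mul_sn1PDF]

lemma integral_sq_snMeasure (b : ℝ) : ∫ x, x ^ 2 ∂snMeasure b = 1 := by
  rw [integral_snMeasure, integral_even_pow_mul_sn1PDF b even_two]
  simpa [integral_stdNormalPDF] using integral_pow_add_two_mul_stdNormalPDF 0

lemma integral_pow_four_snMeasure (b : ℝ) : ∫ x, x ^ 4 ∂snMeasure b = 3 := by
  rw [integral_snMeasure, integral_even_pow_mul_sn1PDF b (by decide)]
  have h0 := integral_pow_add_two_mul_stdNormalPDF 0
  have h2 := integral_pow_add_two_mul_stdNormalPDF 2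
  simp only [zero_add, pow_zero, one_mul, integral_stdNormalPDF] at h0 h2
  rw [h2, h0]
  norm_num

/-- A product of measures with real densities has the product density. -/
lemma pi_withDensity_ofReal {ι : Type*} [Fintype ι] (f : ι → ℝ → ℝ) (hf : ∀ i x, 0 ≤ f i x)
    (hfi : ∀ i, Integrable (f i)) :
    Measure.pi (fun i => (volume : Measure ℝ).withDensity fun x => ENNReal.ofReal (f i x)) =
      (volume : Measure (ι → ℝ)).withDensity fun x => ENNReal.ofReal (∏ i, f i (x i)) := by
  have : ∀ i, IsFiniteMeasure
      ((volume : Measure ℝ).withDensity fun x => ENNReal.ofReal (f i x)) := fun i =>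
    isFiniteMeasure_withDensity_ofReal (hfi i).2
  refine Measure.pi_eq fun s hs => ?_
  rw [withDensity_apply _ (MeasurableSet.univ_pi hs), volume_pi, Measure.restrict_pi_pi,
    ← ofReal_integral_eq_lintegral_ofReal
      (Integrable.fintype_prod fun i => (hfi i).restrict)
      (ae_of_all _ fun x => Finset.prod_nonneg fun i _ => hf i _),
    integral_fintype_prod_eq_prod,
    ENNReal.ofReal_prod_of_nonneg fun i _ => integral_nonneg (hf i)]
  refine Finset.prod_congr rfl fun i _ => ?_
  rw [withDensity_apply _ (hs i),
    ofReal_integral_eq_lintegral_ofReal (hfi i).restrict (ae_of_all _ (hf i))]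

/-- Some orthogonal matrix has the direction of a given vector as a prescribed column. -/
lemma exists_orthogonal_vecMul_eq_single {ι : Type*} [Fintype ι] [DecidableEq ι] (w : ι → ℝ)
    (i₀ : ι) : ∃ O : Matrix ι ι ℝ, O * Oᵀ = 1 ∧ w ᵥ* O = Pi.single i₀ (Real.sqrt (w ⬝ᵥ w)) := by
  set v : EuclideanSpace ℝ ι := WithLp.toLp 2 w with hv
  have hnorm : ‖v‖ = Real.sqrt (w ⬝ᵥ w) := by
    rw [EuclideanSpace.norm_eq]
    simp [dotProduct, hv, sq]
  have key : ∃ b : OrthonormalBasis ι ℝ (EuclideanSpace ℝ ι), v = ‖v‖ • b i₀ := by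
    by_cases h0 : v = 0
    · exact ⟨EuclideanSpace.basisFun ι ℝ, by simp [h0]⟩
    · have hn : ‖v‖ ≠ 0 := norm_ne_zero_iff.2 h0
      have ho : Orthonormal ℝ (({i₀} : Set ι).domRestrict fun _ : ι => ‖v‖⁻¹ • v) := by
        refine ⟨fun i => ?_, fun i j hij => absurd (Subsingleton.elim i j) hij⟩
        simp [norm_smul, hn]
      obtain ⟨b, hb⟩ := ho.exists_orthonormalBasis_extension_of_card_eq (by simp)
      refine ⟨b, ?_⟩
      rw [hb i₀ rfl, smul_smul, mul_inv_cancel₀ hn, one_smul]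
  obtain ⟨b, hb⟩ := key
  refine ⟨Matrix.of fun i j => b j i, ?_, ?_⟩
  · rw [mul_eq_one_comm]
    ext i j
    have := orthonormal_iff_ite.1 b.orthonormal j i
    simp only [PiLp.inner_apply, RCLike.inner_apply, conj_trivial] at this
    simp [Matrix.mul_apply, Matrix.one_apply, this, eq_comm]
  · ext j
    have h1 : (w ᵥ* Matrix.of fun i j => b j i) j = inner ℝ (b j) v := by
      simp [Matrix.vecMul, dotProduct, PiLp.inner_apply, hv]
    rw [h1, hb, inner_smul_right, orthonormal_iff_ite.1 b.orthonormal, ← hnorm]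
    simp [Pi.single_apply]

open scoped MatrixOrder in
/-- The square root of `Ω` can be rotated so that the linear form `α` acts on one coordinate. -/
lemma Matrix.PosDef.exists_mul_transpose_eq {ι : Type*} [Fintype ι] [DecidableEq ι]
    {Ωb : Matrix ι ι ℝ} (hΩ : Ωb.PosDef) (α : ι → ℝ) (i₀ : ι) :
    ∃ B : Matrix ι ι ℝ, B * Bᵀ = Ωb ∧
      α ᵥ* B = Pi.single i₀ (Real.sqrt (α ⬝ᵥ (Ωb *ᵥ α))) := by
  obtain ⟨C, hC⟩ := CStarAlgebra.nonneg_iff_eq_star_mul_self.1 hΩ.posSemidef.nonneg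
  replace hC : Ωb = Cᵀ * C := by simpa [star_eq_conjTranspose] using hC
  obtain ⟨O, hO, hO'⟩ := exists_orthogonal_vecMul_eq_single (C *ᵥ α) i₀
  refine ⟨Cᵀ * O, ?_, ?_⟩
  · rw [transpose_mul, transpose_transpose, Matrix.mul_assoc, ← Matrix.mul_assoc O, hO,
      Matrix.one_mul, hC]
  · rw [← vecMul_vecMul, vecMul_transpose, hO', hC, ← mulVec_mulVec, dotProduct_mulVec α,
      vecMul_transpose]

/-- Linear change of variables for measures with a density. -/
lemma map_mulVec_withDensity {ι : Type*} [Fintype ι] [DecidableEq ι] {B : Matrix ι ι ℝ}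
    (hB : B.det ≠ 0) {g : (ι → ℝ) → ENNReal} (hg : Measurable g) :
    Measure.map (fun x => B *ᵥ x)
        (volume.withDensity fun x => ENNReal.ofReal |B.det| * g (B *ᵥ x)) =
      volume.withDensity g := by
  have hm : Measurable fun x : ι → ℝ => B *ᵥ x := by fun_prop
  have hmap : Measure.map (fun x => B *ᵥ x) (volume : Measure (ι → ℝ))
      = ENNReal.ofReal |B.det⁻¹| • volume := Real.map_matrix_volume_pi_eq_smul_volume_pi hB
  ext s hs
  rw [Measure.map_apply hm hs, withDensity_apply _ (hm hs), withDensity_apply _ hs,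
    lintegral_const_mul _ (show Measurable fun x => g (B *ᵥ x) from hg.comp hm),
    ← setLIntegral_map hs hg hm, hmap,
    Measure.restrict_smul, lintegral_smul_measure, smul_eq_mul, ← mul_assoc,
    ← ENNReal.ofReal_mul (abs_nonneg _), ← abs_mul, mul_inv_cancel₀ hB]
  simp

lemma sn1PDF_zero : sn1PDF 0 = stdNormalPDF := by
  ext x
  have := stdNormalCDF_add_neg 0
  rw [neg_zero] at this
  simp only [sn1PDF, zero_mul]
  linear_combination stdNormalPDF x * this

lemma mvnPDF_mulVec {d : ℕ} {B : Matrix (Fin d) (Fin d) ℝ} (hB : B.det ≠ 0) (x : Fin d → ℝ) :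
    |B.det| * mvnPDF (B * Bᵀ) (B *ᵥ x) = ∏ i, stdNormalPDF (x i) := by
  have hu : IsUnit B.det := isUnit_iff_ne_zero.2 hB
  have hut : IsUnit Bᵀ.det := by rwa [det_transpose]
  have h1 : (B *ᵥ x) ⬝ᵥ ((B * Bᵀ)⁻¹ *ᵥ (B *ᵥ x)) = ∑ i, x i ^ 2 := by
    rw [Matrix.mul_inv_rev, mulVec_mulVec, Matrix.mul_assoc, nonsing_inv_mul _ hu,
      Matrix.mul_one, ← vecMul_transpose, ← dotProduct_mulVec, mulVec_mulVec,
      mul_nonsing_inv _ hut, one_mulVec]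
    simp [dotProduct, sq]
  have h2 : (B * Bᵀ).det ^ (-(1 : ℝ) / 2) = |B.det|⁻¹ := by
    rw [det_mul, det_transpose, ← abs_mul_abs_self, ← sq, ← Real.rpow_natCast,
      ← Real.rpow_mul (abs_nonneg _)]
    norm_num
    exact Real.rpow_neg_one _
  have h3 : (2 * Real.pi) ^ (-(d : ℝ) / 2) = ((Real.sqrt (2 * Real.pi))⁻¹) ^ d := by
    rw [Real.sqrt_eq_rpow, ← Real.rpow_neg (by positivity), ← Real.rpow_natCast,
      ← Real.rpow_mul (by positivity)]
    congr 1
    ring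
  simp only [mvnPDF, stdNormalPDF]
  rw [h1, h2, h3, Finset.prod_mul_distrib, ← Real.exp_sum, Finset.prod_const, Finset.card_univ,
    Fintype.card_fin, ← Finset.sum_div, Finset.sum_neg_distrib]
  field_simp [abs_ne_zero.2 hB]

lemma scaleMat_eq_one {d : ℕ} {Ωb : Matrix (Fin d) (Fin d) ℝ} (hcorr : ∀ i, Ωb i i = 1) :
    scaleMat Ωb = 1 := by
  simp [scaleMat, hcorr]

/-- In canonical coordinates the skew-normal density is a product. -/
lemma snPDF_mulVec {d : ℕ} {α : Fin d → ℝ} {B : Matrix (Fin d) (Fin d) ℝ} (hB : B.det ≠ 0)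
    (hcorr : ∀ i, (B * Bᵀ) i i = 1) {i₀ : Fin d} {a : ℝ} (hα : α ᵥ* B = Pi.single i₀ a)
    (x : Fin d → ℝ) :
    |B.det| * snPDF 0 (B * Bᵀ) α (B *ᵥ x)
      = ∏ i, sn1PDF ((Pi.single i₀ a : Fin d → ℝ) i) (x i) := by
  have h1 : ∏ i, sn1PDF ((Pi.single i₀ a : Fin d → ℝ) i) (x i)
      = ∏ i, (stdNormalPDF (x i) * if i = i₀ then 2 * stdNormalCDF (a * x i₀) else 1) := by
    refine Finset.prod_congr rfl fun i _ => ?_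
    by_cases hi : i = i₀
    · subst hi
      simp [sn1PDF]
      ring
    · simp [hi, sn1PDF_zero]
  rw [h1, Finset.prod_mul_distrib, Finset.prod_ite_eq' Finset.univ i₀, if_pos (Finset.mem_univ _),
    ← mvnPDF_mulVec hB]
  simp only [snPDF, sub_zero, scaleMat_eq_one hcorr, inv_one, one_mulVec]
  rw [dotProduct_mulVec, hα, single_dotProduct]
  ring

lemma continuous_snPDF {d : ℕ} (ξ : Fin d → ℝ) (Ωm : Matrix (Fin d) (Fin d) ℝ) (α : Fin d → ℝ) :
    Continuous (snPDF ξ Ωm α) := by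
  have := continuous_stdNormalCDF
  unfold snPDF mvnPDF
  fun_prop

/-- Canonical form of a skew-normal vector: independent components, all but one of them
standard normal. -/
lemma IsSN.map_inv_mulVec {Ω' : Type*} [MeasurableSpace Ω'] {P : Measure Ω'} {d : ℕ}
    {Z : Ω' → Fin d → ℝ} {α : Fin d → ℝ} {B : Matrix (Fin d) (Fin d) ℝ}
    (hZ : IsSN P Z 0 (B * Bᵀ) α) (hZm : Measurable Z) (hB : B.det ≠ 0)
    (hcorr : ∀ i, (B * Bᵀ) i i = 1) {i₀ : Fin d} {a : ℝ} (hα : α ᵥ* B = Pi.single i₀ a) :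
    Measure.map (fun t => B⁻¹ *ᵥ Z t) P
      = Measure.pi fun i => snMeasure ((Pi.single i₀ a : Fin d → ℝ) i) := by
  have hm : Measurable fun x : Fin d → ℝ => B *ᵥ x := by fun_prop
  have hm' : Measurable fun x : Fin d → ℝ => B⁻¹ *ᵥ x := by fun_prop
  have h : Measure.map (fun x => B *ᵥ x)
      (Measure.pi fun i => snMeasure ((Pi.single i₀ a : Fin d → ℝ) i)) = Measure.map Z P := by
    rw [hZ, ← map_mulVec_withDensity hB (continuous_snPDF _ _ _).measurable.ennreal_ofReal]
    unfold snMeasure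
    rw [pi_withDensity_ofReal _ (fun i x => sn1PDF_nonneg _ x)
      (fun i => by simpa using integrable_pow_mul_sn1PDF _ 0)]
    simp_rw [← snPDF_mulVec hB hcorr hα, ENNReal.ofReal_mul (abs_nonneg _)]
  have h2 : (fun t => B⁻¹ *ᵥ Z t) = (fun x => B⁻¹ *ᵥ x) ∘ Z := rfl
  rw [h2, ← Measure.map_map hm' hZm, ← h, Measure.map_map hm' hm]
  have h3 : (fun x => B⁻¹ *ᵥ x) ∘ (fun x => B *ᵥ x) = (id : (Fin d → ℝ) → _) := by
    ext1 x
    simp [mulVec_mulVec, nonsing_inv_mul _ (isUnit_iff_ne_zero.2 hB)]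
  rw [h3, Measure.map_id]

section Moments

variable {Ω' : Type*} [MeasurableSpace Ω'] {P : Measure Ω'}

lemma integrable_pow_of_integrable_pow_four [IsFiniteMeasure P] {S : Ω' → ℝ} (hS : Measurable S)
    (hS4 : Integrable (fun t => S t ^ 4) P) {k : ℕ} (hk : k ≤ 4) :
    Integrable (fun t => S t ^ k) P := by
  refine ((integrable_const (1 : ℝ)).add hS4).mono' (by fun_prop) (ae_of_all _ fun t => ?_)
  have h4 : S t ^ 4 = |S t| ^ 4 := by rw [← abs_pow, abs_of_nonneg (by positivity)]
  rw [Pi.add_apply, norm_pow, Real.norm_eq_abs, h4]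
  rcases le_total |S t| 1 with h | h
  · linarith [pow_le_one₀ (n := k) (abs_nonneg _) h, pow_nonneg (abs_nonneg (S t)) 4]
  · linarith [pow_le_pow_right₀ h hk]

lemma ProbabilityTheory.IndepFun.integrable_pow_mul_pow {S U : Ω' → ℝ} (h : IndepFun S U P)
    {j k : ℕ} (hS : Integrable (fun t => S t ^ j) P) (hU : Integrable (fun t => U t ^ k) P) :
    Integrable (fun t => S t ^ j * U t ^ k) P :=
  (h.comp (measurable_id.pow_const j) (measurable_id.pow_const k)).integrable_mul hS hU

lemma ProbabilityTheory.IndepFun.integral_pow_mul_pow {S U : Ω' → ℝ} (h : IndepFun S U P)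
    (hS : Measurable S) (hU : Measurable U) (j k : ℕ) :
    ∫ t, S t ^ j * U t ^ k ∂P = (∫ t, S t ^ j ∂P) * ∫ t, U t ^ k ∂P :=
  (h.comp (measurable_id.pow_const j) (measurable_id.pow_const k)).integral_fun_mul_eq_mul_integral
    (hS.pow_const j).aestronglyMeasurable (hU.pow_const k).aestronglyMeasurable

lemma ProbabilityTheory.IndepFun.prodMk_left_of_prodMk_right [IsFiniteMeasure P]
    {α β γ : Type*} [MeasurableSpace α]
    [MeasurableSpace β] [MeasurableSpace γ] {S : Ω' → α} {U : Ω' → β} {T : Ω' → γ}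
    (hS : Measurable S) (hU : Measurable U) (hT : Measurable T)
    (h : IndepFun S (fun t => (U t, T t)) P) (hUT : IndepFun U T P) :
    IndepFun (fun t => (S t, U t)) T P := by
  have hSU : IndepFun S U P := h.comp measurable_id measurable_fst
  rw [indepFun_iff_map_prod_eq_prod_map_map (hS.prodMk hU).aemeasurable hT.aemeasurable,
    hSU.map_prod_eq_prod_map_map hS.aemeasurable hU.aemeasurable]
  have e1 := h.map_prod_eq_prod_map_map hS.aemeasurable (hU.prodMk hT).aemeasurable
  rw [hUT.map_prod_eq_prod_map_map hU.aemeasurable hT.aemeasurable] at e1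
  refine MeasurableEquiv.map_measurableEquiv_injective MeasurableEquiv.prodAssoc ?_
  rw [Measure.prodAssoc_prod, ← e1, Measure.map_map (by fun_prop) (by fun_prop)]
  rfl

/-- Mean of the skew-normal law `SN₁(0,1,b)`. -/
def snMean (b : ℝ) : ℝ := Real.sqrt (2 / Real.pi) * (b / Real.sqrt (1 + b ^ 2))

lemma map_eval_of_map_eq_pi {ι : Type*} [Fintype ι] {X : Ω' → ι → ℝ} (hXm : Measurable X)
    {ν : ι → Measure ℝ} [∀ i, IsProbabilityMeasure (ν i)] (hX : Measure.map X P = Measure.pi ν)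
    (i : ι) : Measure.map (fun t => X t i) P = ν i := by
  have h := (measurePreserving_eval ν i).map_eq
  rw [← hX, Measure.map_map (measurable_pi_apply i) hXm] at h
  exact h

lemma iIndepFun_of_map_eq_pi [IsProbabilityMeasure P] {ι : Type*} [Fintype ι] {X : Ω' → ι → ℝ}
    (hXm : Measurable X) {ν : ι → Measure ℝ} [∀ i, IsProbabilityMeasure (ν i)]
    (hX : Measure.map X P = Measure.pi ν) : iIndepFun (fun i t => X t i) P := by
  rw [iIndepFun_iff_map_fun_eq_pi_map fun i => by fun_prop]
  simp_rw [map_eval_of_map_eq_pi hXm hX]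
  exact hX

lemma integral_comp_of_map_eq {U : Ω' → ℝ} (hU : Measurable U) {ν : Measure ℝ}
    (h : Measure.map U P = ν) (k : ℕ) : ∫ t, U t ^ k ∂P = ∫ x, x ^ k ∂ν := by
  rw [← h, integral_map hU.aemeasurable (by fun_prop)]

lemma integrable_pow_of_map_eq_snMeasure {U : Ω' → ℝ} (hU : Measurable U) {b : ℝ}
    (h : Measure.map U P = snMeasure b) (k : ℕ) : Integrable (fun t => U t ^ k) P := by
  have := integrable_pow_snMeasure b k
  rw [← h] at this
  exact this.comp_measurable hU

lemma integral_of_map_eq_snMeasure {U : Ω' → ℝ} (hU : Measurable U) {b : ℝ}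
    (h : Measure.map U P = snMeasure b) : ∫ t, U t ∂P = snMean b := by
  have h1 := integral_comp_of_map_eq hU h 1
  simp only [pow_one] at h1
  rw [h1, integral_id_snMeasure, snMean]

lemma integral_sq_of_map_eq_snMeasure {U : Ω' → ℝ} (hU : Measurable U) {b : ℝ}
    (h : Measure.map U P = snMeasure b) : ∫ t, U t ^ 2 ∂P = 1 := by
  rw [integral_comp_of_map_eq hU h, integral_sq_snMeasure]

lemma integral_pow_four_of_map_eq_snMeasure {U : Ω' → ℝ} (hU : Measurable U) {b : ℝ}
    (h : Measure.map U P = snMeasure b) : ∫ t, U t ^ 4 ∂P = 3 := by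
  rw [integral_comp_of_map_eq hU h, integral_pow_four_snMeasure]

section ScaledSkewNormal

variable [IsProbabilityMeasure P] {S U : Ω' → ℝ} {b : ℝ}

/-- Second moment of `S U - E(S) E(U)`. -/
lemma integral_mul_sub_sq (hS : Measurable S) (hS4 : Integrable (fun t => S t ^ 4) P)
    (hU : Measurable U) (hUlaw : Measure.map U P = snMeasure b) (h : IndepFun S U P) :
    ∫ t, (S t * U t - (∫ t, S t ∂P) * snMean b) ^ 2 ∂P
      = (∫ t, S t ^ 2 ∂P) - ((∫ t, S t ∂P) * snMean b) ^ 2 := by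
  set m := (∫ t, S t ∂P) * snMean b with hm
  have hSi := fun k (hk : k ≤ 4) => integrable_pow_of_integrable_pow_four hS hS4 hk
  have hUi := integrable_pow_of_map_eq_snMeasure hU hUlaw
  have i2 := h.integrable_pow_mul_pow (hSi 2 (by norm_num)) (hUi 2)
  have i1 := h.integrable_pow_mul_pow (hSi 1 (by norm_num)) (hUi 1)
  have e2 := h.integral_pow_mul_pow hS hU 2 2
  have e1 := h.integral_pow_mul_pow hS hU 1 1
  rw [integral_sq_of_map_eq_snMeasure hU hUlaw] at e2
  simp only [pow_one, integral_of_map_eq_snMeasure hU hUlaw] at e1 i1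
  have e : ∀ t, (S t * U t - m) ^ 2 = S t ^ 2 * U t ^ 2 - 2 * m * (S t * U t) + m ^ 2 :=
    fun t => by ring
  have j : Integrable (fun t => S t ^ 2 * U t ^ 2 - 2 * m * (S t * U t)) P :=
    i2.sub (i1.const_mul _)
  simp_rw [e]
  rw [integral_add j (integrable_const _),
    integral_sub i2 (i1.const_mul _), integral_const_mul, e1, e2, integral_const]
  simp only [probReal_univ, smul_eq_mul, ← hm]
  ring

/-- Second moment of `S U - E(S) E(U)` weighted by `S ^ 2`. -/
lemma integral_sq_mul_mul_sub_sq (hS : Measurable S) (hS4 : Integrable (fun t => S t ^ 4) P)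
    (hU : Measurable U) (hUlaw : Measure.map U P = snMeasure b) (h : IndepFun S U P) (m : ℝ) :
    Integrable (fun t => S t ^ 2 * (S t * U t - m) ^ 2) P ∧
    ∫ t, S t ^ 2 * (S t * U t - m) ^ 2 ∂P
      = (∫ t, S t ^ 4 ∂P) - 2 * m * ((∫ t, S t ^ 3 ∂P) * snMean b)
        + m ^ 2 * ∫ t, S t ^ 2 ∂P := by
  have hSi := fun k (hk : k ≤ 4) => integrable_pow_of_integrable_pow_four hS hS4 hk
  have hUi := integrable_pow_of_map_eq_snMeasure hU hUlaw
  have i2 := h.integrable_pow_mul_pow hS4 (hUi 2)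
  have i1 := h.integrable_pow_mul_pow (hSi 3 (by norm_num)) (hUi 1)
  have i0 := hSi 2 (by norm_num)
  have e2 := h.integral_pow_mul_pow hS hU 4 2
  have e1 := h.integral_pow_mul_pow hS hU 3 1
  rw [integral_sq_of_map_eq_snMeasure hU hUlaw] at e2
  simp only [pow_one, integral_of_map_eq_snMeasure hU hUlaw] at e1 i1
  have e : (fun t => S t ^ 2 * (S t * U t - m) ^ 2)
      = fun t => S t ^ 4 * U t ^ 2 - 2 * m * (S t ^ 3 * U t) + m ^ 2 * S t ^ 2 := by
    ext t
    ring
  rw [e]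
  have j : Integrable (fun t => S t ^ 4 * U t ^ 2 - 2 * m * (S t ^ 3 * U t)) P :=
    i2.sub (i1.const_mul _)
  refine ⟨j.add (i0.const_mul _), ?_⟩
  rw [integral_add j (i0.const_mul _),
    integral_sub i2 (i1.const_mul _), integral_const_mul, integral_const_mul, e1, e2]
  ring

lemma integrable_mul_sub_pow_four (hS : Measurable S) (hS4 : Integrable (fun t => S t ^ 4) P)
    (hU : Measurable U) (hUlaw : Measure.map U P = snMeasure b) (h : IndepFun S U P) (m : ℝ) :
    Integrable (fun t => (S t * U t - m) ^ 4) P := by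
  have i := fun k (hk : k ≤ 4) => h.integrable_pow_mul_pow
    (integrable_pow_of_integrable_pow_four hS hS4 hk)
    (integrable_pow_of_map_eq_snMeasure hU hUlaw k)
  have e : (fun t => (S t * U t - m) ^ 4)
      = fun t => S t ^ 4 * U t ^ 4 - 4 * m * (S t ^ 3 * U t ^ 3) + 6 * m ^ 2 * (S t ^ 2 * U t ^ 2)
        - 4 * m ^ 3 * (S t ^ 1 * U t ^ 1) + m ^ 4 := by
    ext t
    ring
  rw [e]
  exact ((((i 4 le_rfl).sub ((i 3 (by norm_num)).const_mul _)).add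
    ((i 2 (by norm_num)).const_mul _)).sub ((i 1 (by norm_num)).const_mul _)).add
    (integrable_const _)

/-- The variance of `S U` is positive when `S` is. -/
lemma sq_integral_mul_snMean_lt (hS : Measurable S) (hS4 : Integrable (fun t => S t ^ 4) P)
    (hSpos : ∀ᵐ t ∂P, 0 < S t) (b : ℝ) :
    0 < ∫ t, S t ^ 2 ∂P ∧ ((∫ t, S t ∂P) * snMean b) ^ 2 < ∫ t, S t ^ 2 ∂P := by
  have i2 := integrable_pow_of_integrable_pow_four hS hS4 (k := 2) (by norm_num)
  have hpos : 0 < ∫ t, S t ^ 2 ∂P := by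
    refine (integral_pos_iff_support_of_nonneg (fun t => sq_nonneg _) i2).2 ?_
    rw [pos_iff_ne_zero, ← frequently_ae_mem_iff]
    refine Filter.Eventually.frequently (hSpos.mono fun t ht => ?_)
    simp [ht.ne']
  refine ⟨hpos, ?_⟩
  have hvar : (∫ t, S t ∂P) ^ 2 ≤ ∫ t, S t ^ 2 ∂P := by
    have h := variance_nonneg S P
    rw [variance_eq_sub ((memLp_two_iff_integrable_sq hS.aestronglyMeasurable).2 i2)] at h
    simpa using h
  have hmean : snMean b ^ 2 < 1 := by
    rw [snMean, mul_pow, div_pow, Real.sq_sqrt (by positivity), Real.sq_sqrt (by positivity)]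
    have h1 : 2 / Real.pi < 1 := by
      rw [div_lt_one Real.pi_pos]
      linarith [Real.pi_gt_three]
    have h2 : b ^ 2 / (1 + b ^ 2) ≤ 1 := (div_le_one (by positivity)).2 (by linarith)
    exact (mul_le_of_le_one_right (by positivity) h2).trans_lt h1
  rw [mul_pow]
  exact (mul_le_mul_of_nonneg_right hvar (sq_nonneg _)).trans_lt
    (mul_lt_of_lt_one_right hpos hmean)

end ScaledSkewNormal

end Moments

section Canonical

lemma snMean_zero : snMean 0 = 0 := by simp [snMean]

lemma mahalanobis_mulVec {ι : Type*} [Fintype ι] [DecidableEq ι] {M : Matrix ι ι ℝ}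
    (hM : M.det ≠ 0) (C : Matrix ι ι ℝ) (v : ι → ℝ) :
    (M *ᵥ v) ⬝ᵥ ((M * C * Mᵀ)⁻¹ *ᵥ (M *ᵥ v)) = v ⬝ᵥ (C⁻¹ *ᵥ v) := by
  have hu : IsUnit M.det := isUnit_iff_ne_zero.2 hM
  have hut : IsUnit Mᵀ.det := by rwa [det_transpose]
  rw [Matrix.mul_inv_rev, Matrix.mul_inv_rev, mulVec_mulVec, Matrix.mul_assoc, Matrix.mul_assoc,
    nonsing_inv_mul _ hu, Matrix.mul_one, ← vecMul_transpose, ← dotProduct_mulVec, mulVec_mulVec,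
    ← Matrix.mul_assoc, mul_nonsing_inv _ hut, Matrix.one_mul]

variable {Ω' : Type*} [MeasurableSpace Ω'] {P : Measure Ω'}

lemma integral_add_mulVec_apply [IsProbabilityMeasure P] {ι : Type*} [Fintype ι]
    {R : Ω' → ι → ℝ} (hR : ∀ k, Integrable (fun t => R t k) P)
    (ξ : ι → ℝ) (M : Matrix ι ι ℝ) (i : ι) :
    ∫ t, (ξ + M *ᵥ R t) i ∂P = (ξ + M *ᵥ fun k => ∫ t, R t k ∂P) i := by
  simp only [Pi.add_apply, mulVec, dotProduct]
  rw [integral_add (integrable_const _)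
    (integrable_finsetSum _ fun k _ => (hR k).const_mul _),
    integral_finsetSum _ fun k _ => (hR k).const_mul _]
  simp [integral_const_mul]

lemma integral_mulVec_mul_mulVec {ι : Type*} [Fintype ι] {V : Ω' → ι → ℝ}
    (hV : ∀ k l, Integrable (fun t => V t k * V t l) P) (M : Matrix ι ι ℝ) :
    (Matrix.of fun i j => ∫ t, (M *ᵥ V t) i * (M *ᵥ V t) j ∂P)
      = M * (Matrix.of fun k l => ∫ t, V t k * V t l ∂P) * Mᵀ := by
  ext i j
  have e : ∀ t, (M *ᵥ V t) i * (M *ᵥ V t) j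
      = ∑ l, ∑ k, M i k * M j l * (V t k * V t l) := fun t => by
    simp only [mulVec, dotProduct]
    rw [Finset.sum_mul_sum, Finset.sum_comm]
    exact Finset.sum_congr rfl fun _ _ => Finset.sum_congr rfl fun _ _ => by ring
  simp only [Matrix.of_apply, Matrix.mul_apply, transpose_apply, e]
  rw [integral_finsetSum _ fun l _ => integrable_finsetSum _ fun k _ => (hV k l).const_mul _]
  refine Finset.sum_congr rfl fun l _ => ?_
  rw [integral_finsetSum _ fun k _ => (hV k l).const_mul _, Finset.sum_mul]
  refine Finset.sum_congr rfl fun k _ => ?_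
  rw [integral_const_mul]
  ring

variable [IsProbabilityMeasure P] {S : Ω' → ℝ} {n : ℕ} {X : Ω' → Fin (n + 1) → ℝ} {a : ℝ}

/-- Covariance matrix of the mixture in canonical coordinates. -/
lemma covariance_canonical {ι : Type*} [Fintype ι] [DecidableEq ι] {X : Ω' → ι → ℝ} {i₀ : ι}
    (hS : Measurable S) (hS4 : Integrable (fun t => S t ^ 4) P)
    (hX : Measurable X)
    (hXlaw : Measure.map X P =
      Measure.pi fun i => snMeasure ((Pi.single i₀ a : ι → ℝ) i))
    (h : IndepFun S X P) {ρ : ι → ℝ}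
    (hρ : ∀ k, ρ k = (∫ t, S t ∂P) * snMean ((Pi.single i₀ a : ι → ℝ) k)) (k l : ι) :
    Integrable (fun t => (S t * X t k - ρ k) * (S t * X t l - ρ l)) P ∧
    ∫ t, (S t * X t k - ρ k) * (S t * X t l - ρ l) ∂P
      = Matrix.diagonal (fun k => (∫ t, S t ^ 2 ∂P) - ρ k ^ 2) k l := by
  have hXk : ∀ k, Measurable fun t => X t k := fun k => by fun_prop
  have hlaw := map_eval_of_map_eq_pi hX hXlaw
  have hSX : ∀ k, IndepFun S (fun t => X t k) P := fun k =>
    h.comp measurable_id (measurable_pi_apply k)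
  have hSi := fun k (hk : k ≤ 4) => integrable_pow_of_integrable_pow_four hS hS4 hk
  have hprod : Integrable (fun t => X t k * X t l) P :=
    MemLp.integrable_mul (p := 2) (q := 2)
      ((memLp_two_iff_integrable_sq (hXk k).aestronglyMeasurable).2
        (integrable_pow_of_map_eq_snMeasure (hXk k) (hlaw k) 2))
      ((memLp_two_iff_integrable_sq (hXk l).aestronglyMeasurable).2
        (integrable_pow_of_map_eq_snMeasure (hXk l) (hlaw l) 2))
  have hind2 : IndepFun (fun t => S t ^ 2) (fun t => X t k * X t l) P :=
    h.comp (measurable_id.pow_const 2) ((measurable_pi_apply k).mul (measurable_pi_apply l))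
  have i2 : Integrable (fun t => S t ^ 2 * (X t k * X t l)) P :=
    hind2.integrable_mul (hSi 2 (by norm_num)) hprod
  have i1 : ∀ k, Integrable (fun t => S t * X t k) P := fun k => by
    simpa using (hSX k).integrable_pow_mul_pow (hSi 1 (by norm_num))
      (integrable_pow_of_map_eq_snMeasure (hXk k) (hlaw k) 1)
  have e : (fun t => (S t * X t k - ρ k) * (S t * X t l - ρ l))
      = fun t => S t ^ 2 * (X t k * X t l) - ρ l * (S t * X t k)
        - (ρ k * (S t * X t l) - ρ k * ρ l) := by
    ext t
    ring
  have j1 : Integrable (fun t => S t ^ 2 * (X t k * X t l) - ρ l * (S t * X t k)) P :=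
    i2.sub ((i1 k).const_mul _)
  have j2 : Integrable (fun t => ρ k * (S t * X t l) - ρ k * ρ l) P :=
    ((i1 l).const_mul _).sub (integrable_const _)
  refine ⟨e ▸ j1.sub j2, ?_⟩
  by_cases hkl : k = l
  · subst hkl
    have := integral_mul_sub_sq hS hS4 (hXk k) (hlaw k) (hSX k)
    rw [← hρ k] at this
    simpa [← sq] using this
  · have e1 : ∀ k, ∫ t, S t * X t k ∂P = ρ k := fun k => by
      have := (hSX k).integral_pow_mul_pow hS (hXk k) 1 1
      simp only [pow_one, integral_of_map_eq_snMeasure (hXk k) (hlaw k)] at this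
      rw [this, hρ]
    have e3 : ∫ t, X t k * X t l ∂P = 0 := by
      rw [((iIndepFun_of_map_eq_pi hX hXlaw).indepFun hkl).integral_fun_mul_eq_mul_integral
        (hXk k).aestronglyMeasurable (hXk l).aestronglyMeasurable,
        integral_of_map_eq_snMeasure (hXk k) (hlaw k),
        integral_of_map_eq_snMeasure (hXk l) (hlaw l)]
      rcases ne_or_eq k i₀ with hk | rfl
      · simp [Pi.single_eq_of_ne hk, snMean_zero]
      · simp [Pi.single_eq_of_ne (Ne.symm hkl), snMean_zero]
    have e4 : ρ k * ρ l = 0 := by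
      rw [hρ k, hρ l]
      rcases ne_or_eq k i₀ with hk | rfl
      · simp [Pi.single_eq_of_ne hk, snMean_zero]
      · simp [Pi.single_eq_of_ne (Ne.symm hkl), snMean_zero]
    have e2 : ∫ t, S t ^ 2 * (X t k * X t l) ∂P = 0 := by
      rw [hind2.integral_fun_mul_eq_mul_integral (hS.pow_const 2).aestronglyMeasurable
        hprod.aestronglyMeasurable, e3, mul_zero]
    rw [e, integral_sub j1 j2, integral_sub i2 ((i1 k).const_mul _),
      integral_sub ((i1 l).const_mul _) (integrable_const _), integral_const_mul,
      integral_const_mul, integral_const, e1, e1, e2, Matrix.diagonal_apply_ne _ hkl]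
    simp only [probReal_univ, smul_eq_mul]
    linear_combination -e4

/-- Moments of the squared norm of the symmetric components. -/
lemma moments_sum_sq (hX : Measurable X)
    (hXlaw : Measure.map X P =
      Measure.pi fun i => snMeasure ((Pi.single 0 a : Fin (n + 1) → ℝ) i)) :
    Integrable (fun t => ∑ i : Fin n, X t i.succ ^ 2) P ∧
    ∫ t, ∑ i : Fin n, X t i.succ ^ 2 ∂P = n ∧
    Integrable (fun t => (∑ i : Fin n, X t i.succ ^ 2) ^ 2) P ∧
    ∫ t, (∑ i : Fin n, X t i.succ ^ 2) ^ 2 ∂P = n * (n + 2) := by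
  have hXk : ∀ k, Measurable fun t => X t k := fun k => by fun_prop
  have hlaw := map_eval_of_map_eq_pi hX hXlaw
  have hind := iIndepFun_of_map_eq_pi hX hXlaw
  have hi := fun k => integrable_pow_of_map_eq_snMeasure (hXk k) (hlaw k)
  have e2 := fun k => integral_sq_of_map_eq_snMeasure (hXk k) (hlaw k)
  have e4 := fun k => integral_pow_four_of_map_eq_snMeasure (hXk k) (hlaw k)
  have hpair : ∀ i j : Fin n, Integrable (fun t => X t i.succ ^ 2 * X t j.succ ^ 2) P ∧
      ∫ t, X t i.succ ^ 2 * X t j.succ ^ 2 ∂P = 1 + if i = j then 2 else 0 := by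
    intro i j
    by_cases hij : i = j
    · subst hij
      simp only [← pow_add, if_true]
      refine ⟨hi _ 4, ?_⟩
      rw [e4]
      norm_num
    · have h := hind.indepFun (fun hs => hij (Fin.succ_injective _ hs) : i.succ ≠ j.succ)
      refine ⟨h.integrable_pow_mul_pow (hi _ 2) (hi _ 2), ?_⟩
      rw [h.integral_pow_mul_pow (hXk _) (hXk _), e2, e2]
      simp [hij]
  have esq : (fun t => (∑ i : Fin n, X t i.succ ^ 2) ^ 2)
      = fun t => ∑ i : Fin n, ∑ j : Fin n, X t i.succ ^ 2 * X t j.succ ^ 2 := by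
    ext t
    rw [sq, Finset.sum_mul_sum]
  refine ⟨integrable_finsetSum _ fun i _ => hi _ 2, ?_, ?_, ?_⟩
  · rw [integral_finsetSum _ fun i _ => hi _ 2]
    simp [e2]
  · rw [esq]
    exact integrable_finsetSum _ fun i _ => integrable_finsetSum _ fun j _ => (hpair i j).1
  · rw [esq, integral_finsetSum _ fun i _ => integrable_finsetSum _ fun j _ => (hpair i j).1]
    simp_rw [integral_finsetSum _ fun j _ => (hpair _ j).1, (hpair _ _).2]
    simp only [Finset.sum_add_distrib, Finset.sum_ite_eq, Finset.mem_univ, if_true,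
      Finset.sum_const, Finset.card_univ, Fintype.card_fin, nsmul_eq_mul]
    ring

lemma indepFun_sum_sq (hS : Measurable S) (hX : Measurable X)
    (hXlaw : Measure.map X P =
      Measure.pi fun i => snMeasure ((Pi.single 0 a : Fin (n + 1) → ℝ) i))
    (h : IndepFun S X P) :
    IndepFun (fun t => (S t, X t 0)) (fun t => ∑ i : Fin n, X t i.succ ^ 2) P := by
  have hind := iIndepFun_of_map_eq_pi hX hXlaw
  refine IndepFun.prodMk_left_of_prodMk_right hS (by fun_prop) (by fun_prop) ?_ ?_
  · exact h.comp (φ := id) (ψ := fun x : Fin (n + 1) → ℝ => (x 0, ∑ i : Fin n, x i.succ ^ 2))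
      measurable_id (by fun_prop)
  · have h1 := hind.indepFun_finset {0} {0}ᶜ disjoint_compl_right (fun i => by fun_prop)
    have hs : ∀ i : Fin n, i.succ ∈ ({0}ᶜ : Finset (Fin (n + 1))) := fun i => by simp
    exact h1.comp (φ := fun v : ({0} : Finset (Fin (n + 1))) → ℝ => v ⟨0, by simp⟩)
      (ψ := fun v : ({0}ᶜ : Finset (Fin (n + 1))) → ℝ => ∑ i : Fin n, v ⟨i.succ, hs i⟩ ^ 2)
      (by fun_prop) (by fun_prop)

/-- Fourth moment of the Mahalanobis norm of the mixture in canonical coordinates. -/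
lemma integral_mahalanobis_sq_canonical
    (hS : Measurable S) (hS4 : Integrable (fun t => S t ^ 4) P)
    (hX : Measurable X)
    (hXlaw : Measure.map X P =
      Measure.pi fun i => snMeasure ((Pi.single 0 a : Fin (n + 1) → ℝ) i))
    (h : IndepFun S X P) (m p q : ℝ) :
    ∫ t, (p * (S t * X t 0 - m) ^ 2 + q * ∑ i : Fin n, (S t * X t i.succ) ^ 2) ^ 2 ∂P
      = p ^ 2 * ∫ t, (S t * X t 0 - m) ^ 4 ∂P
        + 2 * p * q * n * ((∫ t, S t ^ 4 ∂P) - 2 * m * ((∫ t, S t ^ 3 ∂P) * snMean a)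
            + m ^ 2 * ∫ t, S t ^ 2 ∂P)
        + q ^ 2 * (n * (n + 2)) * ∫ t, S t ^ 4 ∂P := by
  have hU : Measurable fun t => X t 0 := by fun_prop
  have hUlaw : Measure.map (fun t => X t 0) P = snMeasure a := by
    simpa using map_eval_of_map_eq_pi hX hXlaw 0
  have hSU : IndepFun S (fun t => X t 0) P := h.comp measurable_id (measurable_pi_apply 0)
  obtain ⟨iT, eT, iT2, eT2⟩ := moments_sum_sq hX hXlaw
  have hind := indepFun_sum_sq hS hX hXlaw h
  obtain ⟨iB, eB⟩ := integral_sq_mul_mul_sub_sq hS hS4 hU hUlaw hSU m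
  have iA := integrable_mul_sub_pow_four hS hS4 hU hUlaw hSU m
  set T : Ω' → ℝ := fun t => ∑ i : Fin n, X t i.succ ^ 2 with hT
  have hTm : Measurable T := by fun_prop
  have hB : IndepFun (fun t => S t ^ 2 * (S t * X t 0 - m) ^ 2) T P :=
    hind.comp (φ := fun x : ℝ × ℝ => x.1 ^ 2 * (x.1 * x.2 - m) ^ 2) (ψ := id)
      (by fun_prop) measurable_id
  have hC : IndepFun (fun t => S t ^ 4) (fun t => T t ^ 2) P :=
    hind.comp (φ := fun x : ℝ × ℝ => x.1 ^ 4) (ψ := fun x => x ^ 2) (by fun_prop) (by fun_prop)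
  have iBT : Integrable (fun t => S t ^ 2 * (S t * X t 0 - m) ^ 2 * T t) P :=
    hB.integrable_mul iB iT
  have iCT : Integrable (fun t => S t ^ 4 * T t ^ 2) P := hC.integrable_mul hS4 iT2
  have eBT := hB.integral_fun_mul_eq_mul_integral iB.aestronglyMeasurable
    hTm.aestronglyMeasurable
  have eCT := hC.integral_fun_mul_eq_mul_integral hS4.aestronglyMeasurable
    iT2.aestronglyMeasurable
  have e : ∀ t, (p * (S t * X t 0 - m) ^ 2 + q * ∑ i : Fin n, (S t * X t i.succ) ^ 2) ^ 2
      = p ^ 2 * (S t * X t 0 - m) ^ 4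
        + 2 * p * q * (S t ^ 2 * (S t * X t 0 - m) ^ 2 * T t)
        + q ^ 2 * (S t ^ 4 * T t ^ 2) := fun t => by
    have : ∑ i : Fin n, (S t * X t i.succ) ^ 2 = S t ^ 2 * T t := by
      simp only [hT, mul_pow, Finset.mul_sum]
    rw [this]
    ring
  have j : Integrable (fun t => p ^ 2 * (S t * X t 0 - m) ^ 4
        + 2 * p * q * (S t ^ 2 * (S t * X t 0 - m) ^ 2 * T t)) P :=
    (iA.const_mul _).add (iBT.const_mul _)
  simp_rw [e]
  rw [integral_add j (iCT.const_mul _), integral_add (iA.const_mul _) (iBT.const_mul _),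
    integral_const_mul, integral_const_mul, integral_const_mul, eBT, eCT, eB, eT, eT2]
  ring

end Canonical

section Mardia

lemma sq_snMean_sqrt {b : ℝ} (hb : 0 ≤ b) :
    snMean (Real.sqrt b) ^ 2 = 2 / Real.pi * (b / (1 + b)) := by
  rw [snMean, mul_pow, div_pow, Real.sq_sqrt hb, Real.sq_sqrt (by positivity),
    Real.sq_sqrt (by positivity)]

lemma deltaOf_dotProduct_inv_mulVec {d : ℕ} {Ωb : Matrix (Fin d) (Fin d) ℝ} (hΩ : Ωb.PosDef)
    (α : Fin d → ℝ) :
    Real.sqrt (deltaOf Ωb α ⬝ᵥ (Ωb⁻¹ *ᵥ deltaOf Ωb α)) ^ 2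
      = (α ⬝ᵥ (Ωb *ᵥ α)) / (1 + α ⬝ᵥ (Ωb *ᵥ α)) := by
  have h0 : 0 ≤ α ⬝ᵥ (Ωb *ᵥ α) := by
    simpa using hΩ.posSemidef.dotProduct_mulVec_nonneg α
  have hu : IsUnit Ωb.det := isUnit_iff_ne_zero.2 hΩ.det_pos.ne'
  have h : deltaOf Ωb α ⬝ᵥ (Ωb⁻¹ *ᵥ deltaOf Ωb α)
      = (α ⬝ᵥ (Ωb *ᵥ α)) / (1 + α ⬝ᵥ (Ωb *ᵥ α)) := by
    have hs : Real.sqrt (1 + α ⬝ᵥ (Ωb *ᵥ α)) ^ 2 = 1 + α ⬝ᵥ (Ωb *ᵥ α) :=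
      Real.sq_sqrt (by positivity)
    rw [deltaOf, mulVec_smul, mulVec_mulVec, nonsing_inv_mul _ hu, one_mulVec, smul_dotProduct,
      dotProduct_smul, dotProduct_comm _ α, smul_eq_mul, smul_eq_mul, ← mul_assoc, ← sq, inv_pow,
      hs]
    ring
  rw [h, Real.sq_sqrt (by positivity)]

variable {Ω' : Type*} [MeasurableSpace Ω'] {P : Measure Ω'} [IsProbabilityMeasure P]

/-- Fourth moment of the Mahalanobis norm of `ξ + ω S Z` in dimension `n + 1`. -/
lemma integral_mahalanobis_sq_scale_mixture {n : ℕ} {α ξ : Fin (n + 1) → ℝ}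
    {Ωb : Matrix (Fin (n + 1)) (Fin (n + 1)) ℝ} (hΩ : Ωb.PosDef) (hcorr : ∀ i, Ωb i i = 1)
    {ωv : Fin (n + 1) → ℝ} (hωv : ∀ i, 0 < ωv i)
    {Z : Ω' → Fin (n + 1) → ℝ} (hZmeas : Measurable Z) (hZ : IsSN P Z 0 Ωb α)
    {S : Ω' → ℝ} (hSmeas : Measurable S) (hindep : IndepFun S Z P)
    (hS4 : Integrable (fun t => S t ^ 4) P)
    {W : Ω' → ℝ} (hWmeas : Measurable W)
    (hW : Measure.map W P = snMeasure (Real.sqrt (α ⬝ᵥ (Ωb *ᵥ α)))) (hSW : IndepFun S W P)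
    {Y : Ω' → Fin (n + 1) → ℝ} (hY : Y = fun t => ξ + S t • (Matrix.diagonal ωv *ᵥ Z t))
    {μ : Fin (n + 1) → ℝ} (hμ : μ = fun i => ∫ t, Y t i ∂P)
    {Sig : Matrix (Fin (n + 1)) (Fin (n + 1)) ℝ}
    (hSig : Sig = Matrix.of fun i j => ∫ t, (Y t i - μ i) * (Y t j - μ j) ∂P)
    {m : ℝ} (hm : m = (∫ t, S t ∂P) * snMean (Real.sqrt (α ⬝ᵥ (Ωb *ᵥ α))))
    (hES2 : (∫ t, S t ^ 2 ∂P) ≠ 0) (hσ : (∫ t, S t ^ 2 ∂P) - m ^ 2 ≠ 0) :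
    ∫ t, ((Y t - μ) ⬝ᵥ (Sig⁻¹ *ᵥ (Y t - μ))) ^ 2 ∂P
      = (∫ t, (S t * W t - m) ^ 4 ∂P) / ((∫ t, S t ^ 2 ∂P) - m ^ 2) ^ 2
        + 2 * n / (((∫ t, S t ^ 2 ∂P) - m ^ 2) * ∫ t, S t ^ 2 ∂P)
          * ((∫ t, S t ^ 4 ∂P)
            - 2 * m * ((∫ t, S t ^ 3 ∂P) * snMean (Real.sqrt (α ⬝ᵥ (Ωb *ᵥ α))))
            + m ^ 2 * ∫ t, S t ^ 2 ∂P)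
        + n * (n + 2) * (∫ t, S t ^ 4 ∂P) / (∫ t, S t ^ 2 ∂P) ^ 2 := by
  obtain ⟨B, rfl, hα⟩ := hΩ.exists_mul_transpose_eq α 0
  set a := Real.sqrt (α ⬝ᵥ ((B * Bᵀ) *ᵥ α))
  have hBdet : B.det ≠ 0 := fun h0 => hΩ.det_pos.ne' (by rw [det_mul, h0, zero_mul])
  set X : Ω' → Fin (n + 1) → ℝ := fun t => B⁻¹ *ᵥ Z t with hXdef
  have hBm : Measurable fun z : Fin (n + 1) → ℝ => B⁻¹ *ᵥ z := by fun_prop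
  have hX : Measurable X := hBm.comp hZmeas
  have hXlaw : Measure.map X P
      = Measure.pi fun i => snMeasure ((Pi.single 0 a : Fin (n + 1) → ℝ) i) :=
    hZ.map_inv_mulVec hZmeas hBdet hcorr hα
  have hSX : IndepFun S X P := hindep.comp measurable_id hBm
  have hXk : ∀ k, Measurable fun t => X t k := fun k => by fun_prop
  have hlaw := map_eval_of_map_eq_pi hX hXlaw
  have hSXk : ∀ k, IndepFun S (fun t => X t k) P := fun k =>
    hSX.comp measurable_id (measurable_pi_apply k)
  set ρ : Fin (n + 1) → ℝ := Pi.single 0 m with hρdef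
  have hρ : ∀ k, ρ k = (∫ t, S t ∂P) * snMean ((Pi.single 0 a : Fin (n + 1) → ℝ) k) := by
    intro k
    refine Fin.cases ?_ (fun i => ?_) k
    · simp [hρdef, hm]
    · simp [hρdef, snMean_zero]
  have hRi : ∀ k, Integrable (fun t => (S t • X t) k) P := fun k => by
    simpa using (hSXk k).integrable_pow_mul_pow
      (integrable_pow_of_integrable_pow_four hSmeas hS4 (k := 1) (by norm_num))
      (integrable_pow_of_map_eq_snMeasure (hXk k) (hlaw k) 1)
  have hRe : (fun k => ∫ t, (S t • X t) k ∂P) = ρ := by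
    ext k
    have := (hSXk k).integral_pow_mul_pow hSmeas (hXk k) 1 1
    simp only [pow_one, integral_of_map_eq_snMeasure (hXk k) (hlaw k)] at this
    simp only [Pi.smul_apply, smul_eq_mul, this, hρ]
  set M := Matrix.diagonal ωv * B with hM
  have hMdet : M.det ≠ 0 := by
    rw [hM, det_mul, det_diagonal]
    exact mul_ne_zero (Finset.prod_ne_zero_iff.2 fun i _ => (hωv i).ne') hBdet
  have hYM : Y = fun t => ξ + M *ᵥ (S t • X t) := by
    rw [hY]
    ext1 t
    simp only [hXdef, mulVec_smul, mulVec_mulVec, hM]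
    rw [Matrix.mul_assoc, mul_nonsing_inv _ (isUnit_iff_ne_zero.2 hBdet), Matrix.mul_one]
  have hμM : μ = ξ + M *ᵥ ρ := by
    ext i
    rw [hμ, hYM, ← hRe]
    exact integral_add_mulVec_apply hRi ξ M i
  have hYμ : ∀ t, Y t - μ = M *ᵥ (S t • X t - ρ) := fun t => by
    rw [hYM, hμM, mulVec_sub]
    exact add_sub_add_left_eq_sub _ _ _
  have hcov := covariance_canonical hSmeas hS4 hX hXlaw hSX hρ
  have hSigM : Sig = M * Matrix.diagonal (fun k => (∫ t, S t ^ 2 ∂P) - ρ k ^ 2) * Mᵀ := by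
    have h1 : Sig = Matrix.of fun i j =>
        ∫ t, (M *ᵥ (S t • X t - ρ)) i * (M *ᵥ (S t • X t - ρ)) j ∂P := by
      simp_rw [hSig, ← hYμ]
      rfl
    rw [h1, integral_mulVec_mul_mulVec (V := fun t => S t • X t - ρ) fun k l => (hcov k l).1]
    congr 2
    ext k l
    exact (hcov k l).2
  have hquad : ∀ t, (Y t - μ) ⬝ᵥ (Sig⁻¹ *ᵥ (Y t - μ))
      = ((∫ t, S t ^ 2 ∂P) - m ^ 2)⁻¹ * (S t * X t 0 - m) ^ 2
        + (∫ t, S t ^ 2 ∂P)⁻¹ * ∑ i : Fin n, (S t * X t i.succ) ^ 2 := fun t => by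
    have hD : (Matrix.diagonal fun k => (∫ t, S t ^ 2 ∂P) - ρ k ^ 2)⁻¹
        = Matrix.diagonal fun k => ((∫ t, S t ^ 2 ∂P) - ρ k ^ 2)⁻¹ := by
      refine inv_eq_right_inv ?_
      rw [diagonal_mul_diagonal, ← diagonal_one]
      congr 1
      ext k
      refine mul_inv_cancel₀ ?_
      refine Fin.cases ?_ (fun i => ?_) k
      · simpa [hρdef] using hσ
      · simpa [hρdef] using hES2
    rw [hYμ, hSigM, mahalanobis_mulVec hMdet, hD, dotProduct, Fin.sum_univ_succ]
    simp only [mulVec_diagonal, hρdef, Pi.sub_apply, Pi.smul_apply, smul_eq_mul,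
      Pi.single_eq_same, Pi.single_eq_of_ne (Fin.succ_ne_zero _), sub_zero, Finset.mul_sum]
    refine congrArg₂ _ (by ring) (Finset.sum_congr rfl fun i _ => by ring)
  have hlaw4 : ∫ t, (S t * X t 0 - m) ^ 4 ∂P = ∫ t, (S t * W t - m) ^ 4 ∂P := by
    have hmap : Measure.map (fun t => (S t, X t 0)) P = Measure.map (fun t => (S t, W t)) P := by
      rw [(hSXk 0).map_prod_eq_prod_map_map hSmeas.aemeasurable (hXk 0).aemeasurable,
        hSW.map_prod_eq_prod_map_map hSmeas.aemeasurable hWmeas.aemeasurable, hW, hlaw 0,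
        Pi.single_eq_same]
    have hf : AEStronglyMeasurable (fun x : ℝ × ℝ => (x.1 * x.2 - m) ^ 4)
        (Measure.map (fun t => (S t, X t 0)) P) := by fun_prop
    have h1 := integral_map (hSmeas.prodMk (hXk 0)).aemeasurable hf
    rw [hmap] at hf h1
    rw [← h1, integral_map (hSmeas.prodMk hWmeas).aemeasurable hf]
  simp_rw [hquad]
  rw [integral_mahalanobis_sq_canonical hSmeas hS4 hX hXlaw hSX, hlaw4]
  field_simp

end Mardia

/-- Mardia's multivariate excess kurtosis index of a scale mixture of
skew-normal distributions `Y = ξ + ω S Z`. -/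
theorem mardia_kurtosis_scale_mixture
    {Ω' : Type*} [MeasurableSpace Ω'] (P : MeasureTheory.Measure Ω')
    [MeasureTheory.IsProbabilityMeasure P]
    {d : ℕ} (α ξ : Fin d → ℝ) (Ωb : Matrix (Fin d) (Fin d) ℝ)
    (hΩ : Ωb.PosDef) (hcorr : ∀ i, Ωb i i = 1)
    (ωv : Fin d → ℝ) (hωv : ∀ i, 0 < ωv i)
    (Z : Ω' → Fin d → ℝ) (hZmeas : Measurable Z) (hZ : IsSN P Z 0 Ωb α)
    (S : Ω' → ℝ) (hSmeas : Measurable S) (hSpos : ∀ᵐ t ∂P, 0 < S t)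
    (hindep : ProbabilityTheory.IndepFun S Z P)
    (hS4 : Integrable (fun t => S t ^ 4) P)
    -- `W ~ SN₁(0,1,α*)` independent of `S`, so that `Y₁* = S W` is the skewed
    -- component of the canonical form
    (W : Ω' → ℝ) (hWmeas : Measurable W)
    (hW : Measure.map W P = volume.withDensity fun x =>
      ENNReal.ofReal (sn1PDF (Real.sqrt (α ⬝ᵥ (Ωb *ᵥ α))) x))
    (hSW : ProbabilityTheory.IndepFun S W P) :
    let δ := deltaOf Ωb α
    let δstar := Real.sqrt (δ ⬝ᵥ (Ωb⁻¹ *ᵥ δ))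
    let ES := ∫ t, S t ∂P
    let ES2 := ∫ t, S t ^ 2 ∂P
    let ES3 := ∫ t, S t ^ 3 ∂P
    let ES4 := ∫ t, S t ^ 4 ∂P
    let σstar2 := ES2 - (2 / Real.pi) * ES ^ 2 * δstar ^ 2
    let Y := fun t => ξ + S t • (Matrix.diagonal ωv *ᵥ Z t)
    let μ : Fin d → ℝ := fun i => ∫ t, Y t i ∂P
    let Sig : Matrix (Fin d) (Fin d) ℝ :=
      Matrix.of fun i j => ∫ t, (Y t i - μ i) * (Y t j - μ j) ∂P
    let Y1 := fun t => S t * W t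
    let mY1 := ∫ t, Y1 t ∂P
    let β2star := (∫ t, (Y1 t - mY1) ^ 4 ∂P) / (∫ t, (Y1 t - mY1) ^ 2 ∂P) ^ 2
    -- Mardia's excess kurtosis index γ_{2,d} of Y
    (∫ t, ((Y t - μ) ⬝ᵥ (Sig⁻¹ *ᵥ (Y t - μ))) ^ 2 ∂P) - d * (d + 2)
      = β2star + ((d : ℝ) - 1) * ((d : ℝ) + 1) * ES4 / ES2 ^ 2 +
          2 * ((d : ℝ) - 1) / (ES2 * σstar2) *
            (ES4 + (ES ^ 2 * ES2 - 2 * ES * ES3) * (2 / Real.pi) * δstar ^ 2) -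
          (d : ℝ) * ((d : ℝ) + 2) := by
  intro δ δstar ES ES2 ES3 ES4 σstar2 Y μ Sig Y1 mY1 β2star
  set q := α ⬝ᵥ (Ωb *ᵥ α) with hq
  set κ := snMean (Real.sqrt q) with hκ
  have hq0 : 0 ≤ q := by simpa using hΩ.posSemidef.dotProduct_mulVec_nonneg α
  have hδκ : 2 / Real.pi * δstar ^ 2 = κ ^ 2 := by
    rw [sq_snMean_sqrt hq0, ← deltaOf_dotProduct_inv_mulVec hΩ α]
  have hWlaw : Measure.map W P = snMeasure (Real.sqrt q) := hW
  obtain ⟨hES2, hlt⟩ := sq_integral_mul_snMean_lt hSmeas hS4 hSpos (Real.sqrt q)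
  replace hES2 : ES2 ≠ 0 := hES2.ne'
  replace hlt : ES2 - (ES * κ) ^ 2 ≠ 0 := sub_ne_zero.2 hlt.ne'
  have hσ : σstar2 = ES2 - (ES * κ) ^ 2 := by
    linear_combination -(ES ^ 2) * hδκ
  have hmY : mY1 = ES * κ := by
    have := hSW.integral_pow_mul_pow hSmeas hWmeas 1 1
    simpa only [pow_one, integral_of_map_eq_snMeasure hWmeas hWlaw] using this
  have hvar : ∫ t, (Y1 t - mY1) ^ 2 ∂P = ES2 - (ES * κ) ^ 2 := by
    rw [hmY]
    exact integral_mul_sub_sq hSmeas hS4 hWmeas hWlaw hSW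
  rcases d with _ | n
  · have hq00 : q = 0 := by simp [hq]
    have hκ0 : κ = 0 := by rw [hκ, hq00, Real.sqrt_zero, snMean_zero]
    have h4 : ∫ t, (Y1 t - mY1) ^ 4 ∂P = ES4 * 3 := by
      simp only [hmY, hκ0, mul_zero, sub_zero, Y1, mul_pow]
      rw [hSW.integral_pow_mul_pow hSmeas hWmeas,
        integral_pow_four_of_map_eq_snMeasure hWmeas hWlaw]
    have hδ0 : δstar ^ 2 = 0 := by
      rw [hκ0] at hδκ
      simpa [Real.pi_ne_zero] using hδκ
    simp only [β2star, hvar, h4, hσ, hκ0, hδ0]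
    simp only [dotProduct_of_isEmpty, integral_const, Nat.cast_zero, mul_zero, zero_mul, smul_zero,
      zero_sub, sub_zero, zero_add, add_zero, ne_eq, OfNat.ofNat_ne_zero, not_false_eq_true,
      zero_pow]
    field_simp
    ring
  · have hmain := integral_mahalanobis_sq_scale_mixture hΩ hcorr hωv hZmeas hZ hSmeas hindep hS4
      hWmeas hWlaw hSW (Y := Y) (ξ := ξ) rfl (μ := μ) rfl (Sig := Sig) rfl
      (m := ES * κ) rfl hES2 hlt
    have hβ : β2star = (∫ t, (S t * W t - ES * κ) ^ 4 ∂P) / (ES2 - (ES * κ) ^ 2) ^ 2 := by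
      simp only [β2star, hvar]
      rw [hmY]
    have hnum : (ES ^ 2 * ES2 - 2 * ES * ES3) * (2 / Real.pi) * δstar ^ 2
        = (ES * κ) ^ 2 * ES2 - 2 * (ES * κ) * (ES3 * κ) := by
      linear_combination (ES ^ 2 * ES2 - 2 * ES * ES3) * hδκ
    rw [hmain, hβ, hσ, hnum]
    change _ / (ES2 - (ES * κ) ^ 2) ^ 2 + 2 * n / ((ES2 - (ES * κ) ^ 2) * ES2)
      * (ES4 - 2 * (ES * κ) * (ES3 * κ) + (ES * κ) ^ 2 * ES2)
      + n * (n + 2) * ES4 / ES2 ^ 2 - _ = _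
    push_cast
    ring

end
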